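/- There exist 2^{ℵ₀} pairwise distinct varieties of Brouwerian algebras, each of depth 3, none of which is structurally complete. In particular, the variety of all Brouwerian algebras has 2^{ℵ₀} structurally incomplete subvarieties. -/

import Mathlib

universe u

open FirstOrder Language Structure

namespace Paper

variable {L : FirstOrder.Language.{u, u}}

/-- Existential positive sentences/formulas: built from atomic formulas by
conjunction, disjunction and existential quantification. -/
inductive IsEP : {n : ℕ} → L.BoundedFormula Empty n → Prop
  | equal {n} (t₁ t₂ : L.Term (Empty ⊕ Fin n)) : IsEP (t₁.bdEqual t₂)
  | rel {n k} (R : L.Relations k) (ts : Fin k → L.Term (Empty ⊕ Fin n)) :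
      IsEP (BoundedFormula.rel R ts)
  | sup {n} {φ ψ : L.BoundedFormula Empty n} : IsEP φ → IsEP ψ → IsEP (φ ⊔ ψ)
  | inf {n} {φ ψ : L.BoundedFormula Empty n} : IsEP φ → IsEP ψ → IsEP (φ ⊓ ψ)
  | ex {n} {φ : L.BoundedFormula Empty (n + 1)} : IsEP φ → IsEP φ.ex

/-- The direct-product structure on a product of structures. -/
def piStructure {ι : Type u} (M : ι → Type u) [∀ i, L.Structure (M i)] :
    L.Structure (∀ i, M i) where
  funMap f x i := funMap f fun j => x j i
  RelMap r x := ∀ i, RelMap r fun j => x j i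

/-- An (abstract) class of `L`-structures with universes in `Type u`. -/
def StructClass (L : FirstOrder.Language.{u, u}) : Type (u + 1) :=
  ∀ M : Type u, L.Structure M → Prop

def SubClass (K₁ K₂ : StructClass L) : Prop :=
  ∀ (M : Type u) (iM : L.Structure M), K₁ M iM → K₂ M iM

def EqClass (K₁ K₂ : StructClass L) : Prop :=
  ∀ (M : Type u) (iM : L.Structure M), K₁ M iM ↔ K₂ M iM

/-- A quasivariety: a class of structures closed under isomorphisms,
substructures, direct products and ultraproducts. -/
structure IsQuasivariety (K : StructClass L) : Prop where
  iso_closed : ∀ (M : Type u) [iM : L.Structure M] (N : Type u) [iN : L.Structure N],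
      Nonempty (M ≃[L] N) → K M iM → K N iN
  sub_closed : ∀ (M : Type u) [iM : L.Structure M] (N : Type u) [iN : L.Structure N],
      Nonempty (M ↪[L] N) → K N iN → K M iM
  prod_closed : ∀ (ι : Type u) (M : ι → Type u) [iM : ∀ i, L.Structure (M i)],
      (∀ i, K (M i) (iM i)) → K (∀ i, M i) (piStructure M)
  ultra_closed : ∀ (ι : Type u) (M : ι → Type u) [iM : ∀ i, L.Structure (M i)]
      (uf : Ultrafilter ι), (∀ i, K (M i) (iM i)) →
      K ((uf : Filter ι).Product M) inferInstance

/-- A variety: a class of structures closed under isomorphisms, homomorphic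
images, substructures and direct products. -/
structure IsVariety (K : StructClass L) : Prop where
  iso_closed : ∀ (M : Type u) [iM : L.Structure M] (N : Type u) [iN : L.Structure N],
      Nonempty (M ≃[L] N) → K M iM → K N iN
  hom_closed : ∀ (M : Type u) [iM : L.Structure M] (N : Type u) [iN : L.Structure N],
      (∃ h : M →[L] N, Function.Surjective h) → K M iM → K N iN
  sub_closed : ∀ (M : Type u) [iM : L.Structure M] (N : Type u) [iN : L.Structure N],
      Nonempty (M ↪[L] N) → K N iN → K M iM
  prod_closed : ∀ (ι : Type u) (M : ι → Type u) [iM : ∀ i, L.Structure (M i)],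
      (∀ i, K (M i) (iM i)) → K (∀ i, M i) (piStructure M)

/-- The quasivariety generated by a class. -/
def QGen (C : StructClass L) : StructClass L :=
  fun M iM => ∀ K : StructClass L, IsQuasivariety K → SubClass C K → K M iM

/-- The variety generated by a class. -/
def VGen (C : StructClass L) : StructClass L :=
  fun M iM => ∀ K : StructClass L, IsVariety K → SubClass C K → K M iM

/-- The class of isomorphic copies of a single structure. -/
def ClassOf (A : Type u) [iA : L.Structure A] : StructClass L :=
  fun M iM => Nonempty (@FirstOrder.Language.Equiv L M A iM iA)

/-- A class is nontrivial when it has a member with at least two elements. -/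
def NontrivialClass (K : StructClass L) : Prop :=
  ∃ (M : Type u) (iM : L.Structure M), K M iM ∧ Nontrivial M

/-- The joint embedding property. -/
def HasJEP (K : StructClass L) : Prop :=
  ∀ (A : Type u) [iA : L.Structure A] (B : Type u) [iB : L.Structure B],
    K A iA → K B iB → Nontrivial A → Nontrivial B →
    ∃ (C : Type u) (iC : L.Structure C), K C iC ∧
      Nonempty (@FirstOrder.Language.Embedding L A C iA iC) ∧
      Nonempty (@FirstOrder.Language.Embedding L B C iB iC)

/-- There is a homomorphism from `A` into some ultrapower of `B`. -/
def MapsIntoUltrapower (L : FirstOrder.Language.{u, u}) (A B : Type u)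
    [iA : L.Structure A] [iB : L.Structure B] : Prop :=
  ∃ (ι : Type u) (uf : Ultrafilter ι),
    Nonempty (A →[L] ((uf : Filter ι).Product fun _ : ι => B))

/-- There is an embedding of `A` into some ultrapower of `B`. -/
def EmbedsIntoUltrapower (L : FirstOrder.Language.{u, u}) (A B : Type u)
    [iA : L.Structure A] [iB : L.Structure B] : Prop :=
  ∃ (ι : Type u) (uf : Ultrafilter ι),
    Nonempty (A ↪[L] ((uf : Filter ι).Product fun _ : ι => B))

/-- Passive structural completeness: all nontrivial members satisfy the same
existential positive sentences. -/
def IsPSC (K : StructClass L) : Prop :=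
  ∀ (A : Type u) [iA : L.Structure A] (B : Type u) [iB : L.Structure B],
    K A iA → K B iB → Nontrivial A → Nontrivial B →
    ∀ φ : L.Sentence, IsEP φ → (A ⊨ φ → B ⊨ φ)

/-- A relatively simple (K-simple) member of `K`. -/
def RelSimple (K : StructClass L) (A : Type u) [iA : L.Structure A] : Prop :=
  K A iA ∧ Nontrivial A ∧
    ∀ (B : Type u) [iB : L.Structure B], K B iB → Nontrivial B →
      ∀ h : A →[L] B, Function.Surjective h → Function.Injective h

/-- The class of relatively simple members of `K`. -/
def RelSimpleClass (K : StructClass L) : StructClass L :=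
  fun A iA => @RelSimple L K A iA

/-- A relatively subdirectly irreducible member of `K`. -/
def RelSDI (K : StructClass L) (A : Type u) [iA : L.Structure A] : Prop :=
  K A iA ∧
    ∀ (ι : Type u) (M : ι → Type u) [iM : ∀ i, L.Structure (M i)],
      (∀ i, K (M i) (iM i)) →
      ∀ h : @FirstOrder.Language.Embedding L A (∀ i, M i) iA (piStructure M),
        (∀ i, Function.Surjective fun a => h a i) →
        ∃ i, Function.Bijective fun a => h a i

/-- The class of relatively subdirectly irreducible members of `K`. -/
def RelSDIClass (K : StructClass L) : StructClass L :=
  fun A iA => @RelSDI L K A iA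

/-- `K` is relatively semisimple. -/
def RelSemisimple (K : StructClass L) : Prop :=
  ∀ (M : Type u) [iM : L.Structure M], K M iM → RelSDI K M → RelSimple K M

/-- A congruence of a structure. -/
def IsCong (L : FirstOrder.Language.{u, u}) (A : Type u) [iA : L.Structure A] (θ : Setoid A) : Prop :=
  (∀ (n : ℕ) (f : L.Functions n) (x y : Fin n → A),
      (∀ i, θ.r (x i) (y i)) → θ.r (funMap f x) (funMap f y)) ∧
  (∀ (n : ℕ) (r : L.Relations n) (x y : Fin n → A),
      (∀ i, θ.r (x i) (y i)) → (RelMap r x ↔ RelMap r y))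

/-- The prestructure determined by a congruence. -/
def congPrestructure (L : FirstOrder.Language.{u, u}) (A : Type u) [iA : L.Structure A]
    (θ : Setoid A) (h : IsCong L A θ) : L.Prestructure θ where
  toStructure := iA
  fun_equiv := fun x y hxy => h.1 _ _ x y fun i => hxy i
  rel_equiv := fun x y hxy => propext (h.2 _ _ x y fun i => hxy i)

/-- The quotient structure by a congruence. -/
def quotStructure (L : FirstOrder.Language.{u, u}) (A : Type u) [iA : L.Structure A]
    (θ : Setoid A) (h : IsCong L A θ) : L.Structure (Quotient θ) :=
  @FirstOrder.Language.quotientStructure L A θ (congPrestructure L A θ h)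

/-- A `K`-congruence (relative congruence) of `A`. -/
def IsKCong (K : StructClass L) (A : Type u) [iA : L.Structure A] (θ : Setoid A) : Prop :=
  ∃ h : IsCong L A θ, K (Quotient θ) (quotStructure L A θ h)

/-- The total relation `A × A` is a compact element of the lattice of
`K`-congruences of `A`. -/
def TopKCompact (K : StructClass L) (A : Type u) [iA : L.Structure A] : Prop :=
  ∀ S : Set (Setoid A), (∀ θ ∈ S, IsKCong K A θ) →
    (∀ θ : Setoid A, IsKCong K A θ → (∀ σ ∈ S, σ ≤ θ) → θ = ⊤) →
    ∃ S₀ : Set (Setoid A), S₀ ⊆ S ∧ S₀.Finite ∧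
      ∀ θ : Setoid A, IsKCong K A θ → (∀ σ ∈ S₀, σ ≤ θ) → θ = ⊤

/-- `A` has a homomorphic image in `K` that is `K`-simple. -/
def HasRelSimpleImage (K : StructClass L) (A : Type u) [iA : L.Structure A] : Prop :=
  ∃ (B : Type u) (iB : L.Structure B), K B iB ∧
    (∃ h : @FirstOrder.Language.Hom L A B iA iB, Function.Surjective h) ∧
    @RelSimple L K B iB

/-- The language has finitely many operation and relation symbols. -/
def FiniteType (L : FirstOrder.Language.{u, u}) : Prop :=
  Finite (Σ n, L.Functions n) ∧ Finite (Σ n, L.Relations n)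

/-- An algebra is `0`-generated when it is generated by the empty set. -/
def ZeroGen (L : FirstOrder.Language.{u, u}) (A : Type u) [iA : L.Structure A] : Prop :=
  Substructure.closure L (∅ : Set A) = ⊤

/-- `A` has a one-element (trivial) subalgebra. -/
def HasOneElemSub (L : FirstOrder.Language.{u, u}) (A : Type u) [iA : L.Structure A] : Prop :=
  ∃ c : A, ∀ (n : ℕ) (f : L.Functions n), funMap f (fun _ => c) = c

/-- A Kollár class: nontrivial members have no trivial subalgebra. -/
def IsKollar (K : StructClass L) : Prop :=
  ∀ (M : Type u) [iM : L.Structure M], K M iM → Nontrivial M → ¬ HasOneElemSub L M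

/-- `A` is a retract of `B`. -/
def IsRetractOf (L : FirstOrder.Language.{u, u}) (A B : Type u)
    [iA : L.Structure A] [iB : L.Structure B] : Prop :=
  ∃ (g : A →[L] B) (h : B →[L] A), ∀ a : A, h (g a) = a

/-- Validity of an equation in a class. -/
def EqValid (K : StructClass L) (t₁ t₂ : L.Term ℕ) : Prop :=
  ∀ (M : Type u) [iM : L.Structure M], K M iM →
    ∀ v : ℕ → M, t₁.realize v = t₂.realize v

/-- Validity of a quasi-equation (with premise set `Γ`) in a class. -/
def QEqValid (K : StructClass L) (Γ : Set (L.Term ℕ × L.Term ℕ))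
    (t₁ t₂ : L.Term ℕ) : Prop :=
  ∀ (M : Type u) [iM : L.Structure M], K M iM → ∀ v : ℕ → M,
    (∀ p ∈ Γ, Term.realize v p.1 = Term.realize v p.2) →
    t₁.realize v = t₂.realize v

/-- A set of equations is unifiable over `K`. -/
def Unifiable (K : StructClass L) (Γ : Set (L.Term ℕ × L.Term ℕ)) : Prop :=
  ∃ h : ℕ → L.Term ℕ, ∀ p ∈ Γ, EqValid K (p.1.subst h) (p.2.subst h)

/-- No quasi-equation is passive over `K`: every finite set of equations is
unifiable over `K`. -/
def NoPassiveQEq (K : StructClass L) : Prop :=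
  ∀ Γ : Set (L.Term ℕ × L.Term ℕ), Γ.Finite → Unifiable K Γ

/-- The set of variables occurring in a set of equations. -/
def EqnsVars (Γ : Set (L.Term ℕ × L.Term ℕ)) : Set ℕ :=
  ⋃ p ∈ Γ, (↑(p.1.varFinset ∪ p.2.varFinset) : Set ℕ)

/-- `F` is a free `1`-generated algebra for `K`, with free generator `x`. -/
def IsFreeOne (K : StructClass L) (F : Type u) [iF : L.Structure F] (x : F) : Prop :=
  K F iF ∧ Substructure.closure L ({x} : Set F) = ⊤ ∧
    ∀ (M : Type u) [iM : L.Structure M], K M iM → ∀ m : M,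
      ∃ h : F →[L] M, h x = m

/-- A minimal quasivariety. -/
def MinimalQV (K : StructClass L) : Prop :=
  NontrivialClass K ∧ ∀ K' : StructClass L, IsQuasivariety K' → SubClass K' K →
    NontrivialClass K' → EqClass K' K

/-- A trivial class: all members have at most one element. -/
def TrivialClass (K : StructClass L) : Prop :=
  ∀ (M : Type u) [iM : L.Structure M], K M iM → Subsingleton M

/-- The congruence of `A` generated by the pair `(a, b)`. -/
def congGen (L : FirstOrder.Language.{u, u}) (A : Type u) [iA : L.Structure A] (a b : A) : Setoid A :=
  sInf {θ : Setoid A | IsCong L A θ ∧ θ.r a b}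

/-- Equationally definable principal congruences. -/
def HasEDPC (K : StructClass L) : Prop :=
  ∃ S : Finset (L.Term (Fin 4) × L.Term (Fin 4)),
    ∀ (M : Type u) [iM : L.Structure M], K M iM → ∀ a b c d : M,
      ((congGen L M a b).r c d ↔
        ∀ p ∈ S, Term.realize ![a, b, c, d] p.1 = Term.realize ![a, b, c, d] p.2)

/-- A simple algebra: nontrivial, and its only congruences are the identity
and the total relation. -/
def IsSimpleAlg (L : FirstOrder.Language.{u, u}) (A : Type u) [iA : L.Structure A] : Prop :=
  Nontrivial A ∧ ∀ θ : Setoid A, IsCong L A θ → θ = ⊥ ∨ θ = ⊤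

/-- Structural completeness: every subquasivariety generating the same variety
coincides with the class itself. -/
def IsSC (K : StructClass L) : Prop :=
  ∀ K' : StructClass L, IsQuasivariety K' → SubClass K' K →
    EqClass (VGen K') (VGen K) → EqClass K' K


/-! ### The language of Brouwerian algebras -/

/-- Operation symbols for Brouwerian algebras: relative pseudocomplement,
meet, join and the top element `e`. -/
inductive BrOp : ℕ → Type
  | imp : BrOp 2
  | meet : BrOp 2
  | join : BrOp 2
  | e : BrOp 0

/-- The (algebraic) language of Brouwerian algebras. -/
def BrLang : FirstOrder.Language.{0, 0} :=
  { Functions := BrOp, Relations := fun _ => Empty }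

section BrOps

variable {M : Type} [iM : BrLang.Structure M]

/-- Relative pseudocomplement. -/
def bI (a b : M) : M := funMap (L := BrLang) BrOp.imp ![a, b]
/-- Meet. -/
def bM (a b : M) : M := funMap (L := BrLang) BrOp.meet ![a, b]
/-- Join. -/
def bJ (a b : M) : M := funMap (L := BrLang) BrOp.join ![a, b]
/-- Top element. -/
def bE : M := funMap (L := BrLang) BrOp.e ![]
/-- Lattice order. -/
def bLe (a b : M) : Prop := bM a b = a

end BrOps

/-- A Brouwerian algebra: a distributive lattice with greatest element `e`
in which `→` is relative pseudocomplementation: `x ∧ y ≤ z ↔ y ≤ x → z`. -/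
def IsBrouwerian (M : Type) [iM : BrLang.Structure M] : Prop :=
  (∀ a b : M, bM a b = bM b a) ∧
  (∀ a b c : M, bM (bM a b) c = bM a (bM b c)) ∧
  (∀ a b : M, bJ a b = bJ b a) ∧
  (∀ a b c : M, bJ (bJ a b) c = bJ a (bJ b c)) ∧
  (∀ a b : M, bM a (bJ a b) = a) ∧
  (∀ a b : M, bJ a (bM a b) = a) ∧
  (∀ a b c : M, bM a (bJ b c) = bJ (bM a b) (bM a c)) ∧
  (∀ a : M, bLe a bE) ∧
  (∀ a b c : M, bLe (bM a b) c ↔ bLe b (bI a c))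

/-- A prime filter of the lattice reduct of a Brouwerian algebra, where the
whole algebra also counts as a prime filter. -/
def IsPrimeFilterOrTop (M : Type) [iM : BrLang.Structure M] (S : Set M) : Prop :=
  S.Nonempty ∧
  (∀ a b : M, a ∈ S → bLe a b → b ∈ S) ∧
  (∀ a b : M, a ∈ S → b ∈ S → bM a b ∈ S) ∧
  (∀ a b : M, bJ a b ∈ S → a ∈ S ∨ b ∈ S)

/-- The poset of prime filters of `M` has depth at most `3`: there is no
strictly increasing chain of five prime filters. -/
def DepthAtMost3 (M : Type) [iM : BrLang.Structure M] : Prop :=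
  ∀ P₀ P₁ P₂ P₃ P₄ : Set M,
    IsPrimeFilterOrTop M P₀ → IsPrimeFilterOrTop M P₁ →
    IsPrimeFilterOrTop M P₂ → IsPrimeFilterOrTop M P₃ →
    IsPrimeFilterOrTop M P₄ →
    P₀ ⊂ P₁ → P₁ ⊂ P₂ → P₂ ⊂ P₃ → P₃ ⊂ P₄ → False

/-! ### Varieties given by equations and generated quasivarieties -/

section General

variable {L : FirstOrder.Language.{0, 0}}

/-- The class of structures satisfying the equation `t₁ = t₂`. -/
def eqnClass (t₁ t₂ : L.Term ℕ) : StructClass L :=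
  fun M _ => ∀ v : ℕ → M, t₁.realize v = t₂.realize v

/-- The projection of a direct product to a factor. -/
def projHom {ι : Type} (M : ι → Type) [∀ i, L.Structure (M i)] (i : ι) :
    letI := piStructure (L := L) M
    (∀ i, M i) →[L] M i :=
  letI := piStructure (L := L) M
  { toFun := fun x => x i
    map_fun' := fun _ _ => rfl
    map_rel' := fun _ _ h => h i }

/-- The quotient map from a direct product to a reduced product by an ultrafilter. -/
def ultraHom {ι : Type} (M : ι → Type) [∀ i, L.Structure (M i)] (uf : Ultrafilter ι) :
    letI := piStructure (L := L) M
    (∀ i, M i) →[L] (uf : Filter ι).Product M :=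
  letI := piStructure (L := L) M
  { toFun := fun x => Quotient.mk _ x
    map_fun' := fun f x => (Ultraproduct.funMap_cast f x).symm
    map_rel' := fun R x h =>
      (@relMap_quotient_mk' L _ ((uf : Filter ι).productSetoid M)
        (Ultraproduct.setoidPrestructure M uf) _ R x).2 (Filter.Eventually.of_forall h) }

theorem isVariety_eqnClass (t₁ t₂ : L.Term ℕ) : IsVariety (eqnClass t₁ t₂) := by
  have hom : ∀ (M : Type) [iM : L.Structure M] (N : Type) [iN : L.Structure N],
      (∃ h : M →[L] N, Function.Surjective h) → eqnClass t₁ t₂ M iM → eqnClass t₁ t₂ N iN := by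
    rintro M iM N iN ⟨h, hs⟩ hM v
    obtain ⟨g, hg⟩ := hs.hasRightInverse
    have hv : v = h ∘ (g ∘ v) := by
      funext i
      exact (hg (v i)).symm
    rw [hv, HomClass.realize_term, HomClass.realize_term, hM]
  refine ⟨?_, hom, ?_, ?_⟩
  · rintro M iM N iN ⟨h⟩ hM
    exact hom M N ⟨h.toHom, h.surjective⟩ hM
  · rintro M iM N iN ⟨h⟩ hN v
    apply h.injective
    rw [← HomClass.realize_term, ← HomClass.realize_term, hN]
  · intro ι M iM hM
    let := piStructure (L := L) M
    intro v
    funext i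
    have key : ∀ t : L.Term ℕ, t.realize v i = t.realize (fun n => v n i) := fun t =>
      (HomClass.realize_term (projHom M i) (t := t) (v := v)).symm
    rw [key, key, hM i]

/-- The variety generated by a family of structures. -/
def varGen {ι : Type} (A : ι → Type) [iA : ∀ i, L.Structure (A i)] (s : Set ι) : StructClass L :=
  fun M iM => ∀ K : StructClass L, IsVariety K → (∀ i ∈ s, K (A i) (iA i)) → K M iM

variable {ι : Type} {A : ι → Type} [iA : ∀ i, L.Structure (A i)] {s : Set ι}

theorem isVariety_varGen : IsVariety (varGen (L := L) A s) where
  iso_closed M _ N _ h hM K hK hs := hK.iso_closed M N h (hM K hK hs)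
  hom_closed M _ N _ h hM K hK hs := hK.hom_closed M N h (hM K hK hs)
  sub_closed M _ N _ h hM K hK hs := hK.sub_closed M N h (hM K hK hs)
  prod_closed ι M _ hM K hK hs := hK.prod_closed ι M fun i => hM i K hK hs

theorem varGen_self {i : ι} (hi : i ∈ s) : varGen (L := L) A s (A i) (iA i) :=
  fun _ _ hs => hs i hi

theorem varGen_eqn {t₁ t₂ : L.Term ℕ} (h : ∀ i ∈ s, eqnClass t₁ t₂ (A i) (iA i)) :
    SubClass (varGen (L := L) A s) (eqnClass t₁ t₂) :=
  fun _ _ hM => hM _ (isVariety_eqnClass t₁ t₂) h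

theorem IsVariety.ultra_closed {K : StructClass L} (hK : IsVariety K) (ι : Type) (M : ι → Type)
    [iM : ∀ i, L.Structure (M i)] (uf : Ultrafilter ι) (h : ∀ i, K (M i) (iM i)) :
    K ((uf : Filter ι).Product M) inferInstance :=
  letI := piStructure (L := L) M
  hK.hom_closed (∀ i, M i) ((uf : Filter ι).Product M)
    ⟨ultraHom (L := L) M uf, Quotient.mk_surjective⟩ (hK.prod_closed ι M h)

end General

/-! ### The Mints quasi-equation -/

section Mints

theorem Hom.map_bI {M N : Type} [BrLang.Structure M] [BrLang.Structure N] (h : M →[BrLang] N)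
    (a b : M) : h (bI a b) = bI (h a) (h b) :=
  (h.map_fun (n := 2) BrOp.imp ![a, b]).trans
    (congrArg _ (by funext i; fin_cases i <;> rfl))

theorem Hom.map_bJ {M N : Type} [BrLang.Structure M] [BrLang.Structure N] (h : M →[BrLang] N)
    (a b : M) : h (bJ a b) = bJ (h a) (h b) :=
  (h.map_fun (n := 2) BrOp.join ![a, b]).trans
    (congrArg _ (by funext i; fin_cases i <;> rfl))

theorem Hom.map_bE {M N : Type} [BrLang.Structure M] [BrLang.Structure N] (h : M →[BrLang] N) :
    h bE = bE :=
  (h.map_fun (n := 0) BrOp.e ![]).trans (congrArg _ (funext fun i => i.elim0))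

/-- The quasi-equation corresponding to Mints' rule. -/
def Mints : StructClass BrLang := fun M _ =>
  ∀ x y z : M, bI (bI x y) (bJ x z) = bE →
    bJ (bI (bI x y) x) (bI (bI x y) z) = bE

theorem mints_of_embedding {M N : Type} [iM : BrLang.Structure M] [iN : BrLang.Structure N]
    (h : M ↪[BrLang] N) (hN : Mints N iN) : Mints M iM := by
  intro x y z hxyz
  have hp := congrArg h.toHom hxyz
  apply h.injective
  change h.toHom _ = h.toHom _
  simp only [Hom.map_bI, Hom.map_bJ, Hom.map_bE] at hp ⊢
  exact hN _ _ _ hp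

theorem isQuasivariety_inter_mints {K : StructClass BrLang} (hK : IsVariety K) :
    IsQuasivariety fun M iM => K M iM ∧ Mints M iM where
  iso_closed M _ N _ := fun ⟨h⟩ hM =>
    ⟨hK.iso_closed M N ⟨h⟩ hM.1, mints_of_embedding h.symm.toEmbedding hM.2⟩
  sub_closed M _ N _ := fun ⟨h⟩ hN => ⟨hK.sub_closed M N ⟨h⟩ hN.1, mints_of_embedding h hN.2⟩
  prod_closed ι M _ hM := by
    refine ⟨hK.prod_closed ι M fun i => (hM i).1, ?_⟩
    let := piStructure (L := BrLang) M
    intro x y z hxyz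
    funext i
    have hp := congrArg (projHom (L := BrLang) M i) hxyz
    change projHom (L := BrLang) M i (bJ (bI (bI x y) x) (bI (bI x y) z)) =
      projHom (L := BrLang) M i bE
    simp only [Hom.map_bI, Hom.map_bJ, Hom.map_bE] at hp ⊢
    exact (hM i).2 _ _ _ hp
  ultra_closed ι M _ uf hM := by
    refine ⟨hK.ultra_closed ι M uf fun i => (hM i).1, ?_⟩
    let := piStructure (L := BrLang) M
    have hsurj : Function.Surjective (ultraHom (L := BrLang) M uf) := Quotient.mk_surjective
    have heq : ∀ a b : ∀ i, M i, ultraHom (L := BrLang) M uf a = ultraHom (L := BrLang) M uf b ↔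
        ∀ᶠ i in (uf : Filter ι), projHom (L := BrLang) M i a = projHom (L := BrLang) M i b :=
      fun a b => Quotient.eq
    intro x y z
    obtain ⟨x, rfl⟩ := hsurj x
    obtain ⟨y, rfl⟩ := hsurj y
    obtain ⟨z, rfl⟩ := hsurj z
    simp only [← Hom.map_bI, ← Hom.map_bJ, ← Hom.map_bE (ultraHom (L := BrLang) M uf), heq]
    intro h
    filter_upwards [h] with i hi
    simp only [Hom.map_bI, Hom.map_bJ, Hom.map_bE] at hi ⊢
    exact (hM i).2 _ _ _ hi

end Mints

/-! ### Algebras of upsets -/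

/-- The upsets of a preorder. -/
def Ups (P : Type) [Preorder P] : Type := {U : Set P // IsUpperSet U}

section Ups

variable {P : Type} [Preorder P]

instance : BrLang.Structure (Ups P) where
  funMap {n} f x := match n, f, x with
    | _, BrOp.imp, x => ⟨{p | ∀ q, p ≤ q → q ∈ (x 0).1 → q ∈ (x 1).1},
        fun _ _ h hp r hr => hp r (h.trans hr)⟩
    | _, BrOp.meet, x => ⟨(x 0).1 ∩ (x 1).1, (x 0).2.inter (x 1).2⟩
    | _, BrOp.join, x => ⟨(x 0).1 ∪ (x 1).1, (x 0).2.union (x 1).2⟩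
    | _, BrOp.e, _ => ⟨Set.univ, isUpperSet_univ⟩
  RelMap r _ := Empty.elim r

@[ext] theorem Ups.ext {U V : Ups P} (h : ∀ p, p ∈ U.1 ↔ p ∈ V.1) : U = V :=
  Subtype.ext (Set.ext h)

@[simp] theorem mem_bI {U V : Ups P} {p : P} :
    p ∈ (bI U V).1 ↔ ∀ q, p ≤ q → q ∈ U.1 → q ∈ V.1 := Iff.rfl

@[simp] theorem mem_bM {U V : Ups P} {p : P} : p ∈ (bM U V).1 ↔ p ∈ U.1 ∧ p ∈ V.1 := Iff.rfl

@[simp] theorem mem_bJ {U V : Ups P} {p : P} : p ∈ (bJ U V).1 ↔ p ∈ U.1 ∨ p ∈ V.1 := Iff.rfl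

@[simp] theorem mem_bE {p : P} : p ∈ (bE : Ups P).1 := trivial

theorem eq_bE_iff {U : Ups P} : U = bE ↔ ∀ p, p ∈ U.1 :=
  ⟨fun h _ => h ▸ mem_bE, fun h => Ups.ext fun p => ⟨fun _ => mem_bE, fun _ => h p⟩⟩

/-- Restriction of upsets to an upset. -/
def restrictHom {W : Set P} (hW : IsUpperSet W) : Ups P →[BrLang] Ups W where
  toFun U := ⟨{p | (p : P) ∈ U.1}, fun _ _ h hp => U.2 h hp⟩
  map_fun' {n} f x := by
    cases f
    · ext p
      exact ⟨fun h q hq => h q hq, fun h q hq => h ⟨q, hW hq p.2⟩ hq⟩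
    all_goals rfl
  map_rel' r _ := Empty.elim r

theorem restrictHom_surjective {W : Set P} (hW : IsUpperSet W) :
    Function.Surjective (restrictHom hW) := by
  intro U
  refine ⟨⟨{p | ∃ h : p ∈ W, ⟨p, h⟩ ∈ U.1}, fun p q hpq ⟨h, hp⟩ => ⟨hW hpq h, U.2 hpq hp⟩⟩, ?_⟩
  ext p
  exact ⟨fun ⟨_, h⟩ => h, fun h => ⟨p.2, h⟩⟩

end Ups

/-! ### Terms -/

section Terms

/-- Implication of terms. -/
def tI (s t : BrLang.Term ℕ) : BrLang.Term ℕ :=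
  Functions.apply₂ (L := BrLang) BrOp.imp s t
/-- Meet of terms. -/
def tM (s t : BrLang.Term ℕ) : BrLang.Term ℕ :=
  Functions.apply₂ (L := BrLang) BrOp.meet s t
/-- Join of terms. -/
def tJ (s t : BrLang.Term ℕ) : BrLang.Term ℕ :=
  Functions.apply₂ (L := BrLang) BrOp.join s t
/-- The constant term for the top element. -/
def tE : BrLang.Term ℕ := Constants.term (L := BrLang) BrOp.e

variable {M : Type} [BrLang.Structure M] (v : ℕ → M) (s t : BrLang.Term ℕ)

@[simp] theorem realize_tI : (tI s t).realize v = bI (s.realize v) (t.realize v) :=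
  Term.realize_functions_apply₂

@[simp] theorem realize_tM : (tM s t).realize v = bM (s.realize v) (t.realize v) :=
  Term.realize_functions_apply₂

@[simp] theorem realize_tJ : (tJ s t).realize v = bJ (s.realize v) (t.realize v) :=
  Term.realize_functions_apply₂

@[simp] theorem realize_tE : tE.realize v = (bE : M) :=
  congrArg (funMap (L := BrLang) (n := 0) BrOp.e) (funext fun i => i.elim0)

/-- The meet of a list of terms. -/
def bigM (l : List (BrLang.Term ℕ)) : BrLang.Term ℕ := l.foldr tM tE

/-- The join of a list of terms and the variable `0`. -/
def bigJ (l : List (BrLang.Term ℕ)) : BrLang.Term ℕ := l.foldr tJ (Term.var 0)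

variable {P : Type} [Preorder P] (w : ℕ → Ups P)

@[simp] theorem mem_bigM {l : List (BrLang.Term ℕ)} {p : P} :
    p ∈ ((bigM l).realize w).1 ↔ ∀ t ∈ l, p ∈ (t.realize w).1 := by
  induction l with
  | nil => simp [bigM]
  | cons a l ih =>
    change p ∈ ((tM a (bigM l)).realize w).1 ↔ _
    simp [ih]

@[simp] theorem mem_bigJ {l : List (BrLang.Term ℕ)} {p : P} :
    p ∈ ((bigJ l).realize w).1 ↔ p ∈ (w 0).1 ∨ ∃ t ∈ l, p ∈ (t.realize w).1 := by
  induction l with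
  | nil => simp [bigJ]
  | cons a l ih =>
    change p ∈ ((tJ a (bigJ l)).realize w).1 ↔ _
    simp only [realize_tJ, mem_bJ, ih, List.mem_cons, exists_eq_or_imp]
    tauto

/-- Negation of the variable `i + 1` relative to the variable `0`. -/
def negVar (i : ℕ) : BrLang.Term ℕ := tI (Term.var (i + 1)) (Term.var 0)

/-- The join of the negations of the variables `j + 1` with `j < n`. -/
def someNeg (n : ℕ) : BrLang.Term ℕ := bigJ ((List.range n).map negVar)

/-- The join of the negations of the variables `j + 1` with `j < n` and `j ≠ i`. -/
def otherNeg (n i : ℕ) : BrLang.Term ℕ := bigJ (((List.range n).filter (· ≠ i)).map negVar)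

/-- Pairwise disjointness of the variables `i + 1` with `i < n`, relative to the variable `0`. -/
def disjointVars (n : ℕ) : BrLang.Term ℕ :=
  bigM ((List.range n).map fun i => bigM (((List.range n).filter (· ≠ i)).map fun j =>
    tI (tM (Term.var (i + 1)) (Term.var (j + 1))) (Term.var 0)))

/-- A term refuted by the frame with `n` maximal elements and `n` intermediate ones, but by no
other frame of this family. -/
def charTerm (n : ℕ) : BrLang.Term ℕ :=
  tI (tM (disjointVars n)
    (bigM ((List.range n).map fun i => tI (tI (negVar i) (otherNeg n i)) (someNeg n))))
    (someNeg n)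

@[simp] theorem mem_negVar {i : ℕ} {p : P} : p ∈ ((negVar i).realize w).1 ↔
    ∀ q, p ≤ q → q ∈ (w (i + 1)).1 → q ∈ (w 0).1 := by
  simp [negVar]

@[simp] theorem mem_someNeg {n : ℕ} {p : P} : p ∈ ((someNeg n).realize w).1 ↔
    p ∈ (w 0).1 ∨ ∃ j < n, p ∈ ((negVar j).realize w).1 := by
  simp [someNeg]

@[simp] theorem mem_otherNeg {n i : ℕ} {p : P} : p ∈ ((otherNeg n i).realize w).1 ↔
    p ∈ (w 0).1 ∨ ∃ j < n, j ≠ i ∧ p ∈ ((negVar j).realize w).1 := by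
  simp [otherNeg, and_assoc]

@[simp] theorem mem_disjointVars {n : ℕ} {p : P} : p ∈ ((disjointVars n).realize w).1 ↔
    ∀ i < n, ∀ j < n, j ≠ i → ∀ q, p ≤ q → q ∈ (w (i + 1)).1 → q ∈ (w (j + 1)).1 →
      q ∈ (w 0).1 := by
  simp only [disjointVars, mem_bigM, List.mem_map, List.mem_range, List.mem_filter,
    forall_exists_index, and_imp, forall_apply_eq_imp_iff₂, decide_eq_true_eq]
  exact ⟨fun h i hi j hj hji q hq ha hb => h i hi _ j hj hji rfl q hq ⟨ha, hb⟩,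
    fun h i hi _ j hj hji ht => ht ▸ fun q hq hab => h i hi j hj hji q hq hab.1 hab.2⟩

theorem mem_charTerm {n : ℕ} {p : P} : p ∈ ((charTerm n).realize w).1 ↔
    ∀ r, p ≤ r → r ∈ ((disjointVars n).realize w).1 →
      (∀ i < n, ∀ q, r ≤ q →
        (∀ u, q ≤ u → u ∈ ((negVar i).realize w).1 → u ∈ ((otherNeg n i).realize w).1) →
          q ∈ ((someNeg n).realize w).1) →
      r ∈ ((someNeg n).realize w).1 := by
  simp only [charTerm, realize_tI, realize_tM, mem_bI, mem_bM, mem_bigM, List.mem_map,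
    List.mem_range, forall_exists_index, and_imp, forall_apply_eq_imp_iff₂]

/-- The term whose equality with the top element expresses depth at most `3`. -/
def depthTerm : BrLang.Term ℕ :=
  tJ (Term.var 3) (tI (Term.var 3) (tJ (Term.var 2) (tI (Term.var 2)
    (tJ (Term.var 1) (tI (Term.var 1) (Term.var 0))))))

end Terms

/-! ### Deriving the Brouwerian axioms and the depth bound from equations -/

section Axioms

theorem isBrouwerian_of_eqn {M : Type} [iM : BrLang.Structure M]
    (h : ∀ t₁ t₂ : BrLang.Term ℕ,
      (∀ (P : Type) [Preorder P] (v : ℕ → Ups P), t₁.realize v = t₂.realize v) →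
        eqnClass t₁ t₂ M iM) : IsBrouwerian M := by
  let x : BrLang.Term ℕ := Term.var 0
  let y : BrLang.Term ℕ := Term.var 1
  let z : BrLang.Term ℕ := Term.var 2
  let val (a b c : M) : ℕ → M := fun n => if n = 0 then a else if n = 1 then b else c
  have key : ∀ t₁ t₂ : BrLang.Term ℕ,
      (∀ (P : Type) [Preorder P] (v : ℕ → Ups P), t₁.realize v = t₂.realize v) →
      ∀ a b c : M, t₁.realize (val a b c) = t₂.realize (val a b c) :=
    fun t₁ t₂ ht a b c => h t₁ t₂ ht (val a b c)
  have mcomm : ∀ a b : M, bM a b = bM b a := fun a b => by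
    simpa [x, y, val] using key (tM x y) (tM y x)
      (fun P _ v => by ext p; simp [x, y, and_comm]) a b b
  have massoc : ∀ a b c : M, bM (bM a b) c = bM a (bM b c) := fun a b c => by
    simpa [x, y, z, val] using key (tM (tM x y) z) (tM x (tM y z))
      (fun P _ v => by ext p; simp [x, y, z, and_assoc]) a b c
  have jcomm : ∀ a b : M, bJ a b = bJ b a := fun a b => by
    simpa [x, y, val] using key (tJ x y) (tJ y x)
      (fun P _ v => by ext p; simp [x, y, or_comm]) a b b
  have jassoc : ∀ a b c : M, bJ (bJ a b) c = bJ a (bJ b c) := fun a b c => by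
    simpa [x, y, z, val] using key (tJ (tJ x y) z) (tJ x (tJ y z))
      (fun P _ v => by ext p; simp [x, y, z, or_assoc]) a b c
  have mj : ∀ a b : M, bM a (bJ a b) = a := fun a b => by
    simpa [x, y, val] using key (tM x (tJ x y)) x
      (fun P _ v => by ext p; simp [x, y]; tauto) a b b
  have jm : ∀ a b : M, bJ a (bM a b) = a := fun a b => by
    simpa [x, y, val] using key (tJ x (tM x y)) x
      (fun P _ v => by ext p; simp [x, y]; tauto) a b b
  have distrib : ∀ a b c : M, bM a (bJ b c) = bJ (bM a b) (bM a c) := fun a b c => by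
    simpa [x, y, z, val] using key (tM x (tJ y z)) (tJ (tM x y) (tM x z))
      (fun P _ v => by ext p; simp [x, y, z]; tauto) a b c
  have top : ∀ a : M, bLe a bE := fun a => by
    simpa [x, val, bLe] using key (tM x tE) x (fun P _ v => by ext p; simp [x]) a a a
  have mp : ∀ a c : M, bM (bM a (bI a c)) c = bM a (bI a c) := fun a c => by
    simpa [x, y, val] using key (tM (tM x (tI x y)) y) (tM x (tI x y))
      (fun P _ v => by ext p; simp [x, y]; exact fun hp hq => hq p le_rfl hp) a c c
  have unit : ∀ a b c : M, bM b (bI a (bJ (bM a b) c)) = b := fun a b c => by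
    simpa [x, y, z, val] using key (tM y (tI x (tJ (tM x y) z))) y
      (fun P _ v => by
        ext p
        simp [x, y, z]
        exact fun hp q hpq hq => Or.inl ⟨hq, (v 1).2 hpq hp⟩) a b c
  refine ⟨mcomm, massoc, jcomm, jassoc, mj, jm, distrib, top, fun a b c => ⟨fun hle => ?_,
    fun hle => ?_⟩⟩
  · have hj : bJ (bM a b) c = c := by
      conv_lhs => rw [← show bM (bM a b) c = bM a b from hle, jcomm, mcomm _ c]
      exact jm c _
    have := unit a b c
    rwa [hj] at this
  · have hb : bM a b = bM (bM a (bI a c)) b := by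
      conv_lhs => rw [← show bM b (bI a c) = b from hle, mcomm b, ← massoc]
    change bM (bM a b) c = bM a b
    rw [hb, massoc, mcomm b c, ← massoc, mp]

theorem IsBrouwerian.mem_of_imp_mem {M : Type} [BrLang.Structure M] (hM : IsBrouwerian M)
    {S : Set M} (hS : IsPrimeFilterOrTop M S) {a b : M} (ha : a ∈ S) (hab : bI a b ∈ S) :
    b ∈ S := by
  obtain ⟨mcomm, massoc, -, -, mj, jm, -, -, res⟩ := hM
  refine hS.2.1 _ _ (hS.2.2.1 _ _ ha hab) ((res a (bI a b) b).2 ?_)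
  calc bM (bI a b) (bI a b) = bM (bI a b) (bJ (bI a b) (bM (bI a b) (bI a b))) := by rw [jm]
    _ = bI a b := mj _ _

theorem depthAtMost3_of_eqn {M : Type} [iM : BrLang.Structure M] (hM : IsBrouwerian M)
    (h : eqnClass depthTerm tE M iM) : DepthAtMost3 M := by
  intro P₀ P₁ P₂ P₃ P₄ h₀ h₁ h₂ h₃ h₄ h₀₁ h₁₂ h₂₃ h₃₄
  obtain ⟨x₃, hx₃, hx₃'⟩ := Set.exists_of_ssubset h₀₁
  obtain ⟨x₂, hx₂, hx₂'⟩ := Set.exists_of_ssubset h₁₂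
  obtain ⟨x₁, hx₁, hx₁'⟩ := Set.exists_of_ssubset h₂₃
  obtain ⟨x₀, -, hx₀'⟩ := Set.exists_of_ssubset h₃₄
  have heq : bJ x₃ (bI x₃ (bJ x₂ (bI x₂ (bJ x₁ (bI x₁ x₀))))) = bE := by
    simpa [depthTerm] using
      h fun n => if n = 0 then x₀ else if n = 1 then x₁ else if n = 2 then x₂ else x₃
  have hE : (bE : M) ∈ P₀ := by
    obtain ⟨a, ha⟩ := h₀.1
    exact h₀.2.1 a _ ha (hM.2.2.2.2.2.2.2.1 a)
  rw [← heq] at hE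
  have s₁ := hM.mem_of_imp_mem h₁ hx₃ (h₀₁.1 ((h₀.2.2.2 _ _ hE).resolve_left hx₃'))
  have s₂ := hM.mem_of_imp_mem h₂ hx₂ (h₁₂.1 ((h₁.2.2.2 _ _ s₁).resolve_left hx₂'))
  have s₃ := hM.mem_of_imp_mem h₃ hx₁ (h₂₃.1 ((h₂.2.2.2 _ _ s₂).resolve_left hx₁'))
  exact hx₀' s₃

end Axioms

/-! ### The frames -/

/-- The nonminimal points: maximal points `top i` and intermediate points `mid i`, where `mid i`
lies below all the maximal points but `top i`. -/
inductive Node (m : ℕ) : Type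
  | top (i : Fin m)
  | mid (i : Fin m)

/-- The order of `Node m`. -/
def Node.Le {m : ℕ} : Node m → Node m → Prop
  | .top i, .top j => i = j
  | .top _, .mid _ => False
  | .mid i, .top j => i ≠ j
  | .mid i, .mid j => i = j

/-- The points of the frame: the nonminimal ones, a point `pair a b` covered just by `a` and `b`
for all `a` and `b`, and a point `root` below all the nonminimal ones. -/
inductive Pt (m : ℕ) : Type
  | base (a : Node m)
  | pair (a b : Node m)
  | root

namespace Pt

variable {m : ℕ}

/-- The order of `Pt m`. -/
def Le : Pt m → Pt m → Prop
  | base a, base b => a.Le b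
  | pair a b, base c => a.Le c ∨ b.Le c
  | root, base _ => True
  | pair a b, pair c d => a = c ∧ b = d
  | root, root => True
  | _, _ => False

theorem _root_.Paper.Node.le_refl (a : Node m) : a.Le a := by
  cases a <;> rfl

theorem _root_.Paper.Node.le_trans {a b c : Node m} (h : a.Le b) (h' : b.Le c) : a.Le c := by
  cases a <;> cases b <;> cases c <;> simp_all [Node.Le]

instance : Preorder (Pt m) where
  le := Le
  le_refl p := by cases p <;> simp [Le, Node.le_refl]
  le_trans p q r := by
    rcases p with a | ⟨a, b⟩ | _ <;> rcases q with c | ⟨c, d⟩ | _ <;>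
      rcases r with u | ⟨u, v⟩ | _ <;> simp only [Le] <;> try tauto
    · exact Node.le_trans
    · rintro (h | h) h'
      exacts [Or.inl (Node.le_trans h h'), Or.inr (Node.le_trans h h')]
    · rintro ⟨rfl, rfl⟩ h
      exact h
    · rintro ⟨rfl, rfl⟩ h
      exact h

/-- The length of the longest chain above a point, up to an upper bound. -/
def rank : Pt m → ℕ
  | base (.top _) => 0
  | base (.mid _) => 1
  | pair _ _ => 2
  | root => 2

theorem le_pair_base {a b c : Node m} : pair a b ≤ base c ↔ a.Le c ∨ b.Le c := Iff.rfl

theorem root_le_base (a : Node m) : root ≤ base a := trivial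

theorem exists_base_of_le {p q : Pt m} (h : p ≤ q) (hne : q ≠ p) : ∃ a, q = base a := by
  change Le p q at h
  cases p <;> cases q <;> simp_all [Le]

theorem rank_lt {p q : Pt m} (h : p ≤ q) (hne : q ≠ p) : q.rank < p.rank := by
  change Le p q at h
  rcases p with (a | a) | ⟨a, b⟩ | _ <;> rcases q with (c | c) | ⟨c, d⟩ | _ <;>
    simp_all [Le, rank, Node.Le]

theorem rank_le (p : Pt m) : p.rank ≤ 2 := by
  rcases p with (a | a) | ⟨a, b⟩ | _ <;> simp [rank]

theorem eq_mid_top_of_chain {p q r : Pt m} (hpq : p ≤ q) (hqr : q ≤ r) (h : q ≠ p)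
    (h' : r ≠ q) : ∃ k l, q = base (.mid k) ∧ r = base (.top l) ∧ k ≠ l := by
  have h₁ := rank_lt hpq h
  have h₂ := rank_lt hqr h'
  have h₃ := p.rank_le
  change Le q r at hqr
  rcases q with (a | a) | ⟨a, b⟩ | _ <;> rcases r with (c | c) | ⟨c, d⟩ | _ <;>
    simp_all [Le, rank, Node.Le] <;> omega

theorem eq_of_pair_le_mid {a b : Node m} {k : Fin m} (h : pair a b ≤ base (.mid k)) :
    a = .mid k ∨ b = .mid k := by
  rw [le_pair_base] at h
  cases a <;> cases b <;> simp_all [Node.Le]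

theorem mints : Mints (Ups (Pt m)) inferInstance := by
  intro x y z h
  rw [eq_bE_iff] at h ⊢
  intro p
  rw [mem_bJ]
  by_contra! hp
  simp only [mem_bI, not_forall] at hp
  obtain ⟨⟨a, hpa, haS, hax⟩, b, hpb, hbS, hbz⟩ := hp
  simp only [mem_bI, mem_bJ] at h
  have haz := (h a a le_rfl haS).resolve_left hax
  have hbx := (h b b le_rfl hbS).resolve_right hbz
  have hap : a ≠ p := by
    rintro rfl
    exact hbz (z.2 hpb haz)
  have hbp : b ≠ p := by
    rintro rfl
    exact hax (x.2 hpa hbx)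
  obtain ⟨a, rfl⟩ := exists_base_of_le hpa hap
  obtain ⟨b, rfl⟩ := exists_base_of_le hpb hbp
  have hsa : pair a b ≤ base a := Or.inl a.le_refl
  have hsb : pair a b ≤ base b := Or.inr b.le_refl
  have hsx : pair a b ∉ x.1 := fun hs => hax (x.2 hsa hs)
  have hsS : ∀ q, pair a b ≤ q → q ∈ x.1 → q ∈ y.1 := by
    intro q hq hqx
    have hne : q ≠ pair a b := by
      rintro rfl
      exact hsx hqx
    obtain ⟨c, rfl⟩ := exists_base_of_le hq hne
    rcases hq with hq | hq
    · exact haS (base c) hq hqx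
    · exact hbS (base c) hq hqx
  rcases h _ (pair a b) le_rfl hsS with hs | hs
  · exact hsx hs
  · exact hbz (z.2 hsb hs)

theorem depth_eqn : eqnClass depthTerm tE (Ups (Pt m)) inferInstance := by
  intro v
  rw [realize_tE, eq_bE_iff]
  intro p
  by_contra hp
  simp only [depthTerm, realize_tJ, realize_tI, Term.realize_var, mem_bJ, mem_bI, not_or,
    not_forall] at hp
  obtain ⟨h₃, q, hpq, hq, h₂, r, hqr, hr, h₁, s, hrs, hs, -⟩ := hp
  have e₁ := rank_lt hpq (by rintro rfl; exact h₃ hq)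
  have e₂ := rank_lt hqr (by rintro rfl; exact h₂ hr)
  have e₃ := rank_lt hrs (by rintro rfl; exact h₁ hs)
  have := p.rank_le
  omega

theorem eq_of_top_le {j : Fin m} {q : Pt m} (h : base (.top j) ≤ q) : q = base (.top j) := by
  by_contra hne
  exact absurd (rank_lt h hne) (Nat.not_lt_zero _)

/-- The upset of the maximal points with index in a given set. -/
def tips (J : Set (Fin m)) : Ups (Pt m) :=
  ⟨{p | ∃ j ∈ J, p = base (.top j)}, by
    rintro p q hpq ⟨j, hj, rfl⟩
    exact ⟨j, hj, eq_of_top_le hpq⟩⟩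

theorem top_mem_tips {J : Set (Fin m)} {j : Fin m} : base (.top j) ∈ (tips J).1 ↔ j ∈ J :=
  ⟨fun ⟨_, hi, h⟩ => (Node.top.inj (base.inj h)) ▸ hi, fun h => ⟨j, h, rfl⟩⟩

theorem not_charTerm_eqn (hm : 3 ≤ m) :
    ¬ eqnClass (charTerm m) tE (Ups (Pt m)) inferInstance := by
  intro h
  let v : ℕ → Ups (Pt m) := fun i => tips {j | j.1 + 1 = i}
  have hv₀ : ∀ p, p ∉ (v 0).1 := fun p ⟨j, hj, _⟩ => Nat.succ_ne_zero _ hj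
  have hv : ∀ (i : Fin m) p, p ∈ (v (i.1 + 1)).1 ↔ p = base (.top i) := by
    intro i p
    constructor
    · rintro ⟨j, hj, rfl⟩
      obtain rfl : j = i := Fin.ext (Nat.succ.inj hj)
      rfl
    · rintro rfl
      exact ⟨i, rfl, rfl⟩
  have hneg : ∀ (i : Fin m) p, p ∈ ((negVar i).realize v).1 ↔ ¬ p ≤ base (.top i) := by
    intro i p
    simp only [mem_negVar, hv, hv₀]
    exact ⟨fun hp hle => hp _ hle rfl, fun hp q hq he => hp (he ▸ hq)⟩
  have hmem := (mem_charTerm v).1 (eq_bE_iff.1 ((h v).trans (realize_tE v)) root) root le_rfl ?_ ?_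
  · rw [mem_someNeg] at hmem
    obtain hmem | ⟨j, hj, hmem⟩ := hmem
    · exact hv₀ _ hmem
    · exact (hneg ⟨j, hj⟩ _).1 hmem (root_le_base _)
  · rw [mem_disjointVars]
    intro i hi j hj hji q _ hq hq'
    rw [hv ⟨i, hi⟩] at hq
    rw [hv ⟨j, hj⟩, hq] at hq'
    simp only [base.injEq, Node.top.injEq, Fin.mk.injEq] at hq'
    exact absurd hq'.symm hji
  · intro i hi q hq hu
    rw [mem_someNeg]
    by_cases hr : q = root
    · subst hr
      have hmid := hu (base (.mid ⟨i, hi⟩)) (root_le_base _)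
        ((hneg ⟨i, hi⟩ _).2 fun hle => hle rfl)
      rw [mem_otherNeg] at hmid
      obtain hmid | ⟨j, hj, hji, hmid⟩ := hmid
      · exact absurd hmid (hv₀ _)
      · refine absurd ?_ ((hneg ⟨j, hj⟩ _).1 hmid)
        exact fun he => hji (congrArg Fin.val he).symm
    · right
      obtain ⟨a | a, rfl⟩ := exists_base_of_le hq hr
      · have : Nontrivial (Fin m) := Fin.nontrivial_iff_two_le.2 (by omega)
        obtain ⟨j, hj⟩ := exists_ne a
        exact ⟨j, j.2, (hneg j _).2 fun hle => hj (show a = j from hle).symm⟩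
      · exact ⟨a, a.2, (hneg a _).2 fun hle => hle rfl⟩

theorem charTerm_eqn {n : ℕ} (hn : 3 ≤ n) (hmn : m ≠ n) :
    eqnClass (charTerm n) tE (Ups (Pt m)) inferInstance := by
  intro v
  rw [realize_tE, eq_bE_iff]
  intro p₀
  rw [mem_charTerm]
  intro w _ hdis hgen
  by_contra hw
  rw [mem_disjointVars] at hdis
  -- A point refuting two negations lies strictly below the witnesses.
  have witness : ∀ (u : Pt m), w ≤ u → ∀ j k : Fin n, j ≠ k →
      u ∉ ((negVar j).realize v).1 → u ∉ ((negVar k).realize v).1 →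
      ∃ c, u ≤ c ∧ c ≠ u ∧ c ∈ (v (j + 1)).1 ∧ c ∉ (v 0).1 := by
    intro u hwu j k hjk hj hk
    simp only [mem_negVar, not_forall] at hj hk
    obtain ⟨c, huc, hc, hc₀⟩ := hj
    obtain ⟨d, hud, hd, hd₀⟩ := hk
    refine ⟨c, huc, ?_, hc, hc₀⟩
    rintro rfl
    exact hd₀ (hdis j j.2 k k.2 (fun h => hjk (Fin.ext h).symm) d (hwu.trans hud)
      ((v _).2 hud hc) hd)
  have chain : ∀ q, w ≤ q → q ∉ ((someNeg n).realize v).1 → ∀ i : Fin n, ∃ k : Fin m,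
      q ≤ base (.mid k) ∧ base (.mid k) ≠ q ∧ base (.mid k) ∈ ((negVar i).realize v).1 ∧
      ∀ j : Fin n, j ≠ i → ∃ l, l ≠ k ∧ base (.top l) ∈ (v (j + 1)).1 ∧
        base (.top l) ∉ (v 0).1 := by
    intro q hwq hq i
    have hu := mt (hgen i i.2 q hwq) hq
    simp only [not_forall] at hu
    obtain ⟨u, hqu, hui, huo⟩ := hu
    simp only [mem_otherNeg, not_or, not_exists, not_and] at huo
    have hne : u ≠ q := by
      rintro rfl
      exact hq ((mem_someNeg v).2 (Or.inr ⟨i, i.2, hui⟩))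
    have tops : ∀ j : Fin n, j ≠ i → ∃ k l, u = base (.mid k) ∧ l ≠ k ∧
        base (.top l) ∈ (v (j + 1)).1 ∧ base (.top l) ∉ (v 0).1 := by
      intro j hj
      obtain ⟨j', hj'i, hj'j⟩ := Fin.exists_ne_and_ne_of_two_lt i j (by omega)
      obtain ⟨c, huc, hcu, hc, hc₀⟩ := witness u (hwq.trans hqu) j j' hj'j.symm
        (huo.2 j j.2 fun h => hj (Fin.ext h)) (huo.2 j' j'.2 fun h => hj'i (Fin.ext h))
      obtain ⟨k, l, rfl, rfl, hkl⟩ := eq_mid_top_of_chain hqu huc hne hcu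
      exact ⟨k, l, rfl, hkl.symm, hc, hc₀⟩
    obtain ⟨j₀, hj₀, -⟩ := Fin.exists_ne_and_ne_of_two_lt i i (by omega)
    obtain ⟨k, -, rfl, -⟩ := tops j₀ hj₀
    refine ⟨k, hqu, hne, hui, fun j hj => ?_⟩
    obtain ⟨k', l, hk, hl⟩ := tops j hj
    obtain rfl : k = k' := by simpa using hk
    exact ⟨l, hl⟩
  choose k hwk hkw hkneg hktop using chain w le_rfl hw
  have top_unique : ∀ (i : Fin n) l, base (.top l) ∈ (v (i + 1)).1 → base (.top l) ∉ (v 0).1 →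
      l = k i := by
    intro i l hl hl₀
    by_contra hne
    exact hl₀ ((mem_negVar v).1 (hkneg i) _ (show k i ≠ l from Ne.symm hne) hl)
  have top_mem : ∀ i : Fin n,
      base (.top (k i)) ∈ (v (i + 1)).1 ∧ base (.top (k i)) ∉ (v 0).1 := by
    intro i
    obtain ⟨j, hj, -⟩ := Fin.exists_ne_and_ne_of_two_lt i i (by omega)
    obtain ⟨l, -, hl, hl₀⟩ := hktop j i hj.symm
    rw [← top_unique i l hl hl₀]
    exact ⟨hl, hl₀⟩
  have k_inj : Function.Injective k := by
    intro i j hij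
    by_contra hne
    obtain ⟨l, hl, hl₁, hl₂⟩ := hktop j i hne
    exact hl ((top_unique i l hl₁ hl₂).trans hij)
  have hroot : w = root := by
    rcases w with a | ⟨a, b⟩ | _
    · let i : Fin n := ⟨0, by omega⟩
      have h := rank_lt (hwk i) (hkw i)
      rcases a with a | a <;> simp [rank] at h
    · have hab := fun i => eq_of_pair_le_mid (hwk i)
      have inj : ∀ i j c, c = Node.mid (k i) → c = Node.mid (k j) → i = j := by
        rintro i j _ rfl h
        exact k_inj (Node.mid.inj h)
      have h₀ := hab ⟨0, by omega⟩
      have h₁ := hab ⟨1, by omega⟩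
      have h₂ := hab ⟨2, by omega⟩
      rcases h₀ with h₀ | h₀ <;> rcases h₁ with h₁ | h₁ <;> rcases h₂ with h₂ | h₂ <;>
        first
          | exact absurd (inj _ _ _ h₀ h₁) (by simp)
          | exact absurd (inj _ _ _ h₀ h₂) (by simp)
          | exact absurd (inj _ _ _ h₁ h₂) (by simp)
    · rfl
  subst hroot
  obtain ⟨l, hl⟩ : ∃ l, ∀ i, k i ≠ l := by
    by_contra! hsurj
    exact hmn (by simpa using (Fintype.card_of_bijective ⟨k_inj, hsurj⟩).symm)
  have hlneg : base (.mid l) ∉ ((someNeg n).realize v).1 := by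
    have below : ∀ i, base (.mid l) ≤ base (.top (k i)) := fun i => (hl i).symm
    rw [mem_someNeg]
    rintro (h | ⟨j, hj, h⟩)
    · exact (top_mem ⟨0, by omega⟩).2 ((v 0).2 (below _) h)
    · exact (top_mem ⟨j, hj⟩).2 ((mem_negVar v).1 h _ (below _) (top_mem ⟨j, hj⟩).1)
  obtain ⟨k', hle, hne, -⟩ := chain _ (root_le_base _) hlneg ⟨0, by omega⟩
  exact absurd (rank_lt hle hne) (by simp [rank])

/-- The points above the first intermediate point of `Pt 4`, a maximal fork with three tips. -/
def fork : Set (Pt 4) := Set.Ici (base (.mid 0))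

theorem not_mints_fork : ¬ Mints (Ups fork) inferInstance := by
  intro h
  let r : Ups (Pt 4) → Ups fork := restrictHom (isUpperSet_Ici _)
  have hr : ∀ (J : Set (Fin 4)) j (hj : base (.top j) ∈ fork),
      (⟨_, hj⟩ : fork) ∈ (r (tips J)).1 ↔ j ∈ J := fun _ _ _ => top_mem_tips
  have mem_fork : ∀ j : Fin 4, j ≠ 0 → base (.top j) ∈ fork := fun j hj => hj.symm
  have imp_iff : ∀ (J K : Set (Fin 4)) j (hj : base (.top j) ∈ fork),
      (⟨_, hj⟩ : fork) ∈ (bI (r (tips J)) (r (tips K))).1 ↔ (j ∈ J → j ∈ K) := by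
    intro J K j hj
    rw [← hr J j hj, ← hr K j hj]
    refine ⟨fun hp => hp _ le_rfl, ?_⟩
    rintro hp ⟨q, hq'⟩ hq
    obtain rfl := eq_of_top_le hq
    exact hp
  have hc := h (r (tips {1, 2})) (r (tips {1})) (r (tips {3})) ?_
  · rw [eq_bE_iff] at hc
    rcases hc ⟨base (.mid 0), le_refl (base (.mid 0))⟩ with hc | hc
    · have := hc ⟨_, mem_fork 3 (by decide)⟩ (mem_fork 3 (by decide))
        ((imp_iff _ _ _ _).2 (by simp))
      exact absurd ((hr _ _ _).1 this) (by simp)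
    · have := hc ⟨_, mem_fork 1 (by decide)⟩ (mem_fork 1 (by decide))
        ((imp_iff _ _ _ _).2 (by simp))
      exact absurd ((hr _ _ _).1 this) (by simp)
  · rw [eq_bE_iff]
    rintro p ⟨q, hq⟩ - hS
    by_cases hne : q = base (.mid 0)
    · subst hne
      have := hS ⟨_, mem_fork 2 (by decide)⟩ (mem_fork 2 (by decide)) ((hr _ _ _).2 (by simp))
      exact absurd ((hr _ _ _).1 this) (by simp)
    · have hlt := rank_lt hq hne
      obtain ⟨j | j, rfl⟩ := exists_base_of_le hq hne
      · refine mem_bJ.2 (Or.imp (hr _ _ _).2 (hr _ _ _).2 ?_)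
        have hj : j ≠ 0 := fun h => hq h.symm
        revert hj
        fin_cases j <;> simp
      · simp [rank] at hlt

end Pt

/-- The parameters of the frames generating the variety attached to a set. -/
def params (X : Set ℕ) : Set ℕ := insert 4 ((· + 5) '' X)

/-- The variety attached to a set of natural numbers. -/
def varOf (X : Set ℕ) : StructClass BrLang := varGen (fun m => Ups (Pt m)) (params X)

theorem varOf_injective : Function.Injective varOf := by
  have aux : ∀ X Y, varOf X = varOf Y → X ⊆ Y := by
    intro X Y h n hn
    by_contra hnY
    have hX : varOf X (Ups (Pt (n + 5))) inferInstance :=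
      varGen_self (Or.inr ⟨n, hn, rfl⟩)
    rw [h] at hX
    refine Pt.not_charTerm_eqn (m := n + 5) (by omega)
      (varGen_eqn (fun m hm => Pt.charTerm_eqn (by omega) ?_) _ _ hX)
    rintro rfl
    rcases hm with hm | ⟨k, hk, hm⟩
    · omega
    · obtain rfl : k = n := by simpa using hm
      exact hnY hk
  exact fun X Y h => (aux X Y h).antisymm (aux Y X h.symm)

theorem isBrouwerian_of_varOf {X : Set ℕ} {M : Type} {iM : BrLang.Structure M}
    (hM : varOf X M iM) : IsBrouwerian M :=
  isBrouwerian_of_eqn fun _ _ ht => varGen_eqn (fun _ _ => ht _) M iM hM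

theorem not_isSC_varOf (X : Set ℕ) : ¬ IsSC (varOf X) := by
  intro h
  have hV : IsVariety (varOf X) := isVariety_varGen
  have hsub : SubClass (fun M iM => varOf X M iM ∧ Mints M iM) (varOf X) := fun _ _ hM => hM.1
  have hfork : varOf X (Ups Pt.fork) inferInstance :=
    hV.hom_closed (Ups (Pt 4)) _
      ⟨restrictHom (isUpperSet_Ici _), restrictHom_surjective (isUpperSet_Ici _)⟩
      (varGen_self (Or.inl rfl))
  refine Pt.not_mints_fork ((h _ (isQuasivariety_inter_mints hV) hsub ?_ _ _).2 hfork).2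
  intro M iM
  refine ⟨fun hM K hK hKs => hM K hK fun N iN hN => hKs N iN hN.1, fun hM K hK hKs => ?_⟩
  refine hM K hK fun N iN hN => hN K hK fun m hm => hKs _ _ ⟨varGen_self hm, Pt.mints⟩

/-- there are `2^{ℵ₀}` pairwise distinct varieties of Brouwerian
algebras of depth `3`, none of which is structurally complete. -/
theorem statement_19 :
    ∃ F : Set ℕ → StructClass BrLang,
      Function.Injective F ∧
      ∀ X : Set ℕ,
        IsVariety (F X) ∧
        (∀ (M : Type) (iM : BrLang.Structure M), F X M iM → @IsBrouwerian M iM) ∧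
        (∀ (M : Type) (iM : BrLang.Structure M), F X M iM → @DepthAtMost3 M iM) ∧
        ¬ IsSC (F X) := by
  refine ⟨varOf, varOf_injective, fun X => ⟨isVariety_varGen, fun M iM hM =>
    isBrouwerian_of_varOf hM, fun M iM hM => ?_, not_isSC_varOf X⟩⟩
  exact depthAtMost3_of_eqn (isBrouwerian_of_varOf hM)
    (varGen_eqn (fun _ _ => Pt.depth_eqn) M iM hM)

end Paper
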